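/- For every dimension n ≥ 2 and constants c, C > 0 there exists a constant C' > 0 (depending only on n, c, C) with the following property. Let λ > 2, r > 0, x₀ ∈ ℝⁿ, and let u be a λ-eigenfunction on the ball B(x₀, 2r) which satisfies the Remez-type inequality: for every ball B ⊆ B(x₀, 2r) and every measurable set E ⊆ B with |E| > 0 one has sup_E |u| ≥ c·(c·|E|/|B|)^{C√λ}·sup_B |u|. Then the collection of connected components of {x ∈ B(x₀, 2r) : u(x) ≠ 0} that intersect B(x₀, r) is finite, and its cardinality is at most C'·( λ^{n/2}·rⁿ + λ^{(n−1)/2} ). -/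

import Mathlib

open MeasureTheory Metric Set

/-- The Euclidean Laplacian `Δu = ∑ⱼ ∂²u/∂xⱼ²` of `u : ℝⁿ → ℝ`. -/
noncomputable def lapl (n : ℕ) (u : EuclideanSpace ℝ (Fin n) → ℝ)
    (x : EuclideanSpace ℝ (Fin n)) : ℝ :=
  ∑ j : Fin n,
    fderiv ℝ (fun y => fderiv ℝ u y (EuclideanSpace.single j (1:ℝ))) x
      (EuclideanSpace.single j (1:ℝ))

/-- The `C²` function `max t 0 ^ 3` on the real line. -/
noncomputable def posCube (t : ℝ) : ℝ := max t 0 ^ 3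

theorem hasDerivAt_max_zero_pow_succ (k : ℕ) (hk : 1 ≤ k) (t : ℝ) :
    HasDerivAt (fun t : ℝ => max t 0 ^ (k + 1)) ((k + 1) * max t 0 ^ k) t := by
  rcases lt_trichotomy t 0 with h | h | h
  · have e : (fun t : ℝ => max t 0 ^ (k + 1)) =ᶠ[nhds t] fun _ => (0 : ℝ) := by
      filter_upwards [Iio_mem_nhds h] with y hy
      rw [max_eq_right (le_of_lt hy)]; simp
    rw [max_eq_right h.le, zero_pow (by omega), mul_zero]
    exact (hasDerivAt_const t (0 : ℝ)).congr_of_eventuallyEq e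
  · subst h
    have h0 : (0 : ℝ) ^ k = 0 := zero_pow (by omega)
    have hb : (fun t : ℝ => max t 0 ^ (k + 1)) =O[nhds 0] fun t : ℝ => t ^ (k + 1) := by
      refine Asymptotics.IsBigO.of_bound 1 (Filter.Eventually.of_forall fun t => ?_)
      rw [one_mul, norm_pow, norm_pow]
      refine pow_le_pow_left₀ (norm_nonneg _) ?_ _
      rw [Real.norm_eq_abs, Real.norm_eq_abs, abs_of_nonneg (le_max_right t 0)]
      exact max_le (le_abs_self t) (abs_nonneg t)
    have hl : (fun t : ℝ => t ^ (k + 1)) =o[nhds 0] fun t : ℝ => t := by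
      simpa using Asymptotics.isLittleO_pow_pow (𝕜 := ℝ) (m := 1) (n := k + 1) (by omega)
    rw [max_self, h0, mul_zero, hasDerivAt_iff_isLittleO]
    simpa using hb.trans_isLittleO hl
  · have e : (fun t : ℝ => max t 0 ^ (k + 1)) =ᶠ[nhds t] fun t => t ^ (k + 1) := by
      filter_upwards [Ioi_mem_nhds h] with y hy
      rw [max_eq_left (le_of_lt hy)]
    rw [max_eq_left h.le]
    have := (hasDerivAt_pow (k + 1) t).congr_of_eventuallyEq e
    simpa using this

theorem hasDerivAt_posCube (t : ℝ) : HasDerivAt posCube (3 * max t 0 ^ 2) t := by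
  have := hasDerivAt_max_zero_pow_succ 2 (by norm_num) t
  norm_num at this
  exact this

theorem hasDerivAt_max_zero_sq (t : ℝ) :
    HasDerivAt (fun t : ℝ => 3 * max t 0 ^ 2) (6 * max t 0) t := by
  have := (hasDerivAt_max_zero_pow_succ 1 le_rfl t).const_mul 3
  norm_num at this
  exact this.congr_deriv (by ring)

theorem contDiff_posCube : ContDiff ℝ 2 posCube := by
  have h1 : deriv posCube = fun t => 3 * max t 0 ^ 2 :=
    funext fun t => (hasDerivAt_posCube t).deriv
  have h2 : deriv (fun t : ℝ => 3 * max t 0 ^ 2) = fun t => 6 * max t 0 :=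
    funext fun t => (hasDerivAt_max_zero_sq t).deriv
  rw [show (2 : WithTop ℕ∞) = 1 + 1 by norm_num, contDiff_succ_iff_deriv]
  refine ⟨fun t => (hasDerivAt_posCube t).differentiableAt, by simp, ?_⟩
  rw [h1, show (1 : WithTop ℕ∞) = 0 + 1 by norm_num, contDiff_succ_iff_deriv]
  refine ⟨fun t => (hasDerivAt_max_zero_sq t).differentiableAt, by simp, ?_⟩
  rw [h2]
  exact contDiff_zero.2 (by fun_prop)

/-- The averaging kernel `(1 - |y|²)₊²`. -/
noncomputable def avgKer {n : ℕ} (y : EuclideanSpace ℝ (Fin n)) : ℝ := max (1 - ‖y‖ ^ 2) 0 ^ 2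

/-- A potential of the kernel: `∇ avgPot y = -(avgKer y) y`. -/
noncomputable def avgPot {n : ℕ} (y : EuclideanSpace ℝ (Fin n)) : ℝ := posCube (1 - ‖y‖ ^ 2) / 6

section Kernel

variable {n : ℕ}

theorem continuous_avgKer : Continuous (avgKer (n := n)) := by
  unfold avgKer; fun_prop

theorem avgKer_nonneg (y : EuclideanSpace ℝ (Fin n)) : 0 ≤ avgKer y := by
  unfold avgKer; positivity

theorem avgKer_le_one (y : EuclideanSpace ℝ (Fin n)) : avgKer y ≤ 1 := by
  unfold avgKer
  refine pow_le_one₀ (le_max_right _ _) (max_le ?_ zero_le_one)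
  nlinarith [sq_nonneg ‖y‖]

theorem max_one_sub_norm_sq_eq_zero {y : EuclideanSpace ℝ (Fin n)} (hy : y ∉ ball 0 1) :
    max (1 - ‖y‖ ^ 2) 0 = 0 := by
  rw [mem_ball_zero_iff, not_lt] at hy
  exact max_eq_right (by nlinarith)

theorem avgKer_eq_zero {y : EuclideanSpace ℝ (Fin n)} (hy : y ∉ ball 0 1) : avgKer y = 0 := by
  rw [avgKer, max_one_sub_norm_sq_eq_zero hy]; norm_num

theorem avgPot_eq_zero {y : EuclideanSpace ℝ (Fin n)} (hy : y ∉ ball 0 1) : avgPot y = 0 := by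
  rw [avgPot, posCube, max_one_sub_norm_sq_eq_zero hy]; norm_num

theorem avgPot_nonneg (y : EuclideanSpace ℝ (Fin n)) : 0 ≤ avgPot y := by
  unfold avgPot posCube; positivity

theorem hasCompactSupport_avgKer : HasCompactSupport (avgKer (n := n)) :=
  HasCompactSupport.intro (isCompact_closedBall 0 1)
    fun _ hy => avgKer_eq_zero fun h => hy (ball_subset_closedBall h)

theorem hasCompactSupport_avgPot : HasCompactSupport (avgPot (n := n)) :=
  HasCompactSupport.intro (isCompact_closedBall 0 1)
    fun _ hy => avgPot_eq_zero fun h => hy (ball_subset_closedBall h)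

theorem contDiff_avgPot : ContDiff ℝ 2 (avgPot (n := n)) :=
  (contDiff_posCube.comp (contDiff_const.sub (contDiff_norm_sq ℝ))).div_const 6

theorem integral_avgKer_pos : 0 < ∫ y : EuclideanSpace ℝ (Fin n), avgKer y := by
  refine continuous_avgKer.integral_pos_of_hasCompactSupport_nonneg_nonzero
    hasCompactSupport_avgKer avgKer_nonneg (x := 0) ?_
  simp [avgKer]

theorem fderiv_avgPot_apply (y v : EuclideanSpace ℝ (Fin n)) :
    fderiv ℝ avgPot y v = -(avgKer y * inner ℝ y v) := by
  have h1 : HasFDerivAt (fun y : EuclideanSpace ℝ (Fin n) => 1 - ‖y‖ ^ 2)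
      (-(2 • (innerSL ℝ y))) y := (hasStrictFDerivAt_norm_sq y).hasFDerivAt.const_sub 1
  have h2 := ((hasDerivAt_posCube (1 - ‖y‖ ^ 2)).comp_hasFDerivAt y h1).mul_const (6⁻¹ : ℝ)
  have h3 : HasFDerivAt avgPot _ y := h2
  rw [h3.fderiv]
  simp [avgKer]
  ring

/-- The average of `f` over the ball of radius `t` with respect to `avgKer`. -/
noncomputable def kerAvg (f : EuclideanSpace ℝ (Fin n) → ℝ) (x : EuclideanSpace ℝ (Fin n))
    (t : ℝ) : ℝ :=
  ∫ y, f (x + t • y) * avgKer y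

theorem hasDerivAt_kerAvg_aux {f : EuclideanSpace ℝ (Fin n) → ℝ} (hf : ContDiff ℝ 2 f)
    (x : EuclideanSpace ℝ (Fin n)) (t : ℝ) :
    HasDerivAt (kerAvg f x) (∫ y, fderiv ℝ f (x + t • y) y * avgKer y) t := by
  have hcf : Continuous f := hf.continuous
  have hcd : Continuous (fderiv ℝ f) := hf.continuous_fderiv (by norm_num)
  have hK : IsCompact (Icc (t - 1) (t + 1) ×ˢ closedBall (0 : EuclideanSpace ℝ (Fin n)) 1) :=
    isCompact_Icc.prod (isCompact_closedBall 0 1)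
  have hcont : Continuous fun p : ℝ × EuclideanSpace ℝ (Fin n) =>
      fderiv ℝ f (x + p.1 • p.2) p.2 * avgKer p.2 := by
    have := continuous_avgKer (n := n)
    exact ((hcd.comp (by fun_prop)).clm_apply (by fun_prop)).mul (by fun_prop)
  obtain ⟨B, hB⟩ := hK.exists_bound_of_continuousOn hcont.continuousOn
  have hint : ∀ {h : EuclideanSpace ℝ (Fin n) → ℝ}, Continuous h →
      Integrable fun y => h y * avgKer y := fun hh =>
    (hh.mul continuous_avgKer).integrable_of_hasCompactSupport hasCompactSupport_avgKer.mul_left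
  refine (hasDerivAt_integral_of_dominated_loc_of_deriv_le
    (s := Icc (t - 1) (t + 1)) (bound := (closedBall 0 1).indicator fun _ => B)
    (F := fun s y => f (x + s • y) * avgKer y)
    (F' := fun s y => fderiv ℝ f (x + s • y) y * avgKer y)
    (Icc_mem_nhds (by linarith) (by linarith)) ?_ ?_ ?_ ?_ ?_ ?_).2
  · exact Filter.Eventually.of_forall fun s =>
      (hint (hcf.comp (by fun_prop : Continuous fun y => x + s • y))).aestronglyMeasurable
  · exact hint (hcf.comp (by fun_prop))
  · exact (hcont.comp (by fun_prop : Continuous fun y => (t, y))).aestronglyMeasurable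
  · refine Filter.Eventually.of_forall fun y s hs => ?_
    by_cases hy : y ∈ closedBall (0 : EuclideanSpace ℝ (Fin n)) 1
    · rw [indicator_of_mem hy]
      exact hB (s, y) ⟨hs, hy⟩
    · rw [indicator_of_notMem hy, avgKer_eq_zero fun h => hy (ball_subset_closedBall h)]
      simp
  · refine (integrable_indicator_iff measurableSet_closedBall).2 ?_
    exact integrableOn_const measure_closedBall_lt_top.ne
  · refine Filter.Eventually.of_forall fun y s _ => HasDerivAt.mul_const ?_ _
    have h1 : HasDerivAt (fun s : ℝ => x + s • y) y s := by
      simpa using ((hasDerivAt_id s).smul_const y).const_add x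
    exact ((hf.differentiable (by norm_num)) _).hasFDerivAt.comp_hasDerivAt s h1

theorem hasDerivAt_kerAvg {f : EuclideanSpace ℝ (Fin n) → ℝ} (hf : ContDiff ℝ 2 f)
    (x : EuclideanSpace ℝ (Fin n)) (t : ℝ) :
    HasDerivAt (kerAvg f x) (t * ∫ y, lapl n f (x + t • y) * avgPot y) t := by
  convert hasDerivAt_kerAvg_aux hf x t using 1
  set e : Fin n → EuclideanSpace ℝ (Fin n) := fun j => EuclideanSpace.single j (1 : ℝ) with he
  have hd : ∀ j, ContDiff ℝ 1 fun z => fderiv ℝ f z (e j) := fun j =>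
    (hf.fderiv_right (m := 1) (by norm_num)).clm_apply contDiff_const
  have hsh : ContDiff ℝ 2 fun y : EuclideanSpace ℝ (Fin n) => x + t • y := by fun_prop
  have hd' : ∀ j, ContDiff ℝ 1 fun y => fderiv ℝ f (x + t • y) (e j) := fun j =>
    (hd j).comp (hsh.of_le (by norm_num))
  have hfd : ∀ j y, fderiv ℝ (fun y => fderiv ℝ f (x + t • y) (e j)) y (e j) =
      t * fderiv ℝ (fun z => fderiv ℝ f z (e j)) (x + t • y) (e j) := by
    intro j y
    have h1 : HasFDerivAt (fun y : EuclideanSpace ℝ (Fin n) => x + t • y)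
        (t • ContinuousLinearMap.id ℝ _) y := ((hasFDerivAt_id y).const_smul t).const_add x
    have h2 := (((hd j).differentiable (by norm_num)) (x + t • y)).hasFDerivAt.comp y h1
    have h3 : HasFDerivAt (fun y => fderiv ℝ f (x + t • y) (e j)) _ y := h2
    rw [h3.fderiv]
    simp
  have hcs : ∀ j, HasCompactSupport fun y => fderiv ℝ (avgPot (n := n)) y (e j) := fun j =>
    hasCompactSupport_avgPot.fderiv_apply (𝕜 := ℝ) (e j)
  have hcP : ∀ j, Continuous fun y => fderiv ℝ (avgPot (n := n)) y (e j) := fun j =>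
    (contDiff_avgPot.continuous_fderiv (by norm_num)).clm_apply continuous_const
  have hcd2 : ∀ j, Continuous fun y =>
      fderiv ℝ (fun y => fderiv ℝ f (x + t • y) (e j)) y (e j) := fun j =>
    ((hd' j).continuous_fderiv (by norm_num)).clm_apply continuous_const
  have hi1 : ∀ j, Integrable fun y =>
      fderiv ℝ (fun y => fderiv ℝ f (x + t • y) (e j)) y (e j) * avgPot y := fun j =>
    ((hcd2 j).mul contDiff_avgPot.continuous).integrable_of_hasCompactSupport
      hasCompactSupport_avgPot.mul_left
  have hi2 : ∀ j, Integrable fun y =>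
      fderiv ℝ f (x + t • y) (e j) * fderiv ℝ avgPot y (e j) := fun j =>
    ((hd' j).continuous.mul (hcP j)).integrable_of_hasCompactSupport (hcs j).mul_left
  have hi3 : ∀ j, Integrable fun y => fderiv ℝ f (x + t • y) (e j) * avgPot y := fun j =>
    ((hd' j).continuous.mul contDiff_avgPot.continuous).integrable_of_hasCompactSupport
      hasCompactSupport_avgPot.mul_left
  have hparts : ∀ j, ∫ y, fderiv ℝ f (x + t • y) (e j) * fderiv ℝ avgPot y (e j) =
      -∫ y, fderiv ℝ (fun y => fderiv ℝ f (x + t • y) (e j)) y (e j) * avgPot y := fun j =>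
    integral_mul_fderiv_eq_neg_fderiv_mul_of_integrable (hi1 j) (hi2 j) (hi3 j)
      (fun y _ => ((hd' j).differentiable (by norm_num)) y)
      (fun y _ => (contDiff_avgPot.differentiable (by norm_num)) y)
  have hL : t * ∫ y, lapl n f (x + t • y) * avgPot y =
      ∑ j, ∫ y, fderiv ℝ (fun y => fderiv ℝ f (x + t • y) (e j)) y (e j) * avgPot y := by
    rw [← integral_finsetSum _ fun j _ => hi1 j, ← integral_const_mul]
    refine integral_congr_ae (Filter.Eventually.of_forall fun y => ?_)
    simp only [hfd, lapl, Finset.sum_mul, Finset.mul_sum, mul_assoc]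
    rfl
  have hR : ∫ y, fderiv ℝ f (x + t • y) y * avgKer y =
      ∑ j, -∫ y, fderiv ℝ f (x + t • y) (e j) * fderiv ℝ avgPot y (e j) := by
    simp_rw [← integral_neg]
    rw [← integral_finsetSum (f := fun j y => -(fderiv ℝ f (x + t • y) (e j) *
      fderiv ℝ avgPot y (e j))) _ fun j _ => (hi2 j).neg]
    refine integral_congr_ae (Filter.Eventually.of_forall fun y => ?_)
    have hy : ∀ L : EuclideanSpace ℝ (Fin n) →L[ℝ] ℝ, L y = ∑ j, y j * L (e j) := by
      intro L
      conv_lhs => rw [← (EuclideanSpace.basisFun (Fin n) ℝ).sum_repr y]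
      simp [map_sum, he]
    simp only [fderiv_avgPot_apply, hy (fderiv ℝ f _), Finset.sum_mul]
    refine Finset.sum_congr rfl fun j _ => ?_
    simp [he, EuclideanSpace.inner_single_right]
    ring
  rw [hL, hR]
  exact Finset.sum_congr rfl fun j _ => by rw [hparts j, neg_neg]

theorem continuous_lapl {f : EuclideanSpace ℝ (Fin n) → ℝ} (hf : ContDiff ℝ 2 f) :
    Continuous (lapl n f) := by
  refine continuous_finsetSum _ fun j _ => ?_
  have h1 : ContDiff ℝ 1 fun z => fderiv ℝ f z (EuclideanSpace.single j (1 : ℝ)) :=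
    (hf.fderiv_right (m := 1) (by norm_num)).clm_apply contDiff_const
  exact (h1.continuous_fderiv (by norm_num)).clm_apply continuous_const

theorem lapl_congr {f g : EuclideanSpace ℝ (Fin n) → ℝ} {x : EuclideanSpace ℝ (Fin n)}
    (h : f =ᶠ[nhds x] g) : lapl n f x = lapl n g x := by
  refine Finset.sum_congr rfl fun j _ => ?_
  have h1 : (fun y => fderiv ℝ f y (EuclideanSpace.single j (1 : ℝ))) =ᶠ[nhds x]
      fun y => fderiv ℝ g y (EuclideanSpace.single j (1 : ℝ)) := by
    filter_upwards [h.fderiv (𝕜 := ℝ)] with y hy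
    rw [hy]
  rw [h1.fderiv_eq]

theorem add_smul_mem_ball {x y : EuclideanSpace ℝ (Fin n)} {t s : ℝ} (ht : 0 ≤ t) (hts : t ≤ s)
    (hs : 0 < s) (hy : y ∈ ball (0 : EuclideanSpace ℝ (Fin n)) 1) : x + t • y ∈ ball x s := by
  rw [mem_ball_zero_iff] at hy
  rw [mem_ball_iff_norm, add_sub_cancel_left, norm_smul, Real.norm_of_nonneg ht]
  nlinarith [norm_nonneg y]

/-- Mean value inequality for functions whose Laplacian is bounded below. -/
theorem mul_integral_avgKer_le {f : EuclideanSpace ℝ (Fin n) → ℝ} (hf : ContDiff ℝ 2 f)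
    {x : EuclideanSpace ℝ (Fin n)} {s μ : ℝ} (hs : 0 < s) (hμ : ∀ z ∈ ball x s, -μ ≤ lapl n f z) :
    f x * (∫ y : EuclideanSpace ℝ (Fin n), avgKer y) ≤
      kerAvg f x s + μ * s ^ 2 / 2 * ∫ y : EuclideanSpace ℝ (Fin n), avgPot y := by
  set P := ∫ y : EuclideanSpace ℝ (Fin n), avgPot y with hP
  have hiP : Integrable (avgPot (n := n)) :=
    contDiff_avgPot.continuous.integrable_of_hasCompactSupport hasCompactSupport_avgPot
  have hder : ∀ t, HasDerivAt (fun t => kerAvg f x t + μ * t ^ 2 / 2 * P)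
      (t * (∫ y, lapl n f (x + t • y) * avgPot y) + μ * t * P) t := by
    intro t
    refine (hasDerivAt_kerAvg hf x t).add ?_
    refine ((((hasDerivAt_pow 2 t).const_mul μ).div_const 2).mul_const P).congr_deriv ?_
    rw [show 2 - 1 = 1 from rfl, pow_one]
    push_cast
    ring
  have hmono : MonotoneOn (fun t => kerAvg f x t + μ * t ^ 2 / 2 * P) (Icc 0 s) := by
    refine monotoneOn_of_deriv_nonneg (convex_Icc 0 s)
      (fun t _ => (hder t).continuousAt.continuousWithinAt)
      (fun t _ => (hder t).differentiableAt.differentiableWithinAt) fun t ht => ?_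
    rw [interior_Icc] at ht
    rw [(hder t).deriv]
    have hge : -μ * P ≤ ∫ y, lapl n f (x + t • y) * avgPot y := by
      rw [hP, ← integral_const_mul]
      refine integral_mono (hiP.const_mul _) ?_ fun y => ?_
      · exact (((continuous_lapl hf).comp (by fun_prop)).mul
          contDiff_avgPot.continuous).integrable_of_hasCompactSupport
          hasCompactSupport_avgPot.mul_left
      · by_cases hy : y ∈ ball (0 : EuclideanSpace ℝ (Fin n)) 1
        · exact mul_le_mul_of_nonneg_right
            (hμ _ (add_smul_mem_ball ht.1.le ht.2.le hs hy)) (avgPot_nonneg y)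
        · simp [avgPot_eq_zero hy]
    nlinarith [ht.1]
  have h := hmono (left_mem_Icc.2 hs.le) (right_mem_Icc.2 hs.le) hs.le
  simp only [kerAvg, zero_smul, add_zero, integral_const_mul] at h
  simpa [kerAvg] using h

theorem measureReal_preimage_add_smul (x : EuclideanSpace ℝ (Fin n)) {s : ℝ} (hs : 0 < s)
    (T : Set (EuclideanSpace ℝ (Fin n))) :
    volume.real ((fun y => x + s • y) ⁻¹' T) = (s ^ n)⁻¹ * volume.real T := by
  have h1 : (fun y => x + s • y) ⁻¹' T = (fun y => s • y) ⁻¹' ((fun y => x + y) ⁻¹' T) := rfl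
  rw [h1, Measure.real, Measure.addHaar_preimage_smul _ hs.ne', measure_preimage_add,
    ENNReal.toReal_mul, finrank_euclideanSpace_fin, ENNReal.toReal_ofReal (abs_nonneg _),
    abs_of_pos (by positivity), Measure.real]

/-- Mean value inequality for a function vanishing outside of a set `T`. -/
theorem mul_integral_avgKer_le_measureReal {f : EuclideanSpace ℝ (Fin n) → ℝ}
    {x : EuclideanSpace ℝ (Fin n)} {s S μ Q : ℝ} (hf : ContDiffOn ℝ 2 f (ball x S)) (hs : 0 < s)
    (hsS : s < S) (hμ : ∀ z ∈ ball x s, -μ ≤ lapl n f z) (hQ : 0 ≤ Q)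
    (hfQ : ∀ z ∈ ball x s, f z ≤ Q) {T : Set (EuclideanSpace ℝ (Fin n))} (hT : MeasurableSet T)
    (hfT : ∀ z ∈ ball x s, z ∉ T → f z = 0) :
    f x * (∫ y : EuclideanSpace ℝ (Fin n), avgKer y) ≤
      Q * ((s ^ n)⁻¹ * volume.real (T ∩ ball x s)) +
        μ * s ^ 2 / 2 * ∫ y : EuclideanSpace ℝ (Fin n), avgPot y := by
  let χ : ContDiffBump x := ⟨s, (s + S) / 2, hs, by linarith⟩
  set F : EuclideanSpace ℝ (Fin n) → ℝ := fun z => χ z * f z with hF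
  have hFC : ContDiff ℝ 2 F := by
    rw [contDiff_iff_contDiffAt]
    intro z
    by_cases hz : z ∈ ball x S
    · exact χ.contDiffAt.mul (hf.contDiffAt (isOpen_ball.mem_nhds hz))
    · have : z ∈ (closedBall x ((s + S) / 2))ᶜ := by
        simp only [mem_compl_iff, mem_closedBall, mem_ball] at hz ⊢
        linarith
      refine (contDiffAt_const (c := (0 : ℝ))).congr_of_eventuallyEq ?_
      filter_upwards [isClosed_closedBall.isOpen_compl.mem_nhds this] with w hw
      have : χ w = 0 := χ.zero_of_le_dist (by
        simp only [mem_compl_iff, mem_closedBall, not_le] at hw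
        exact hw.le)
      simp [hF, this]
  have hFf : ∀ z ∈ ball x s, F z = f z := fun z hz => by
    simp [hF, χ.one_of_mem_closedBall (ball_subset_closedBall hz)]
  have hFl : ∀ z ∈ ball x s, lapl n F z = lapl n f z := fun z hz => by
    refine lapl_congr ?_
    filter_upwards [isOpen_ball.mem_nhds hz] with w hw using hFf w hw
  have h := mul_integral_avgKer_le hFC hs (μ := μ) fun z hz => by rw [hFl z hz]; exact hμ z hz
  rw [hFf x (mem_ball_self hs)] at h
  refine h.trans (add_le_add ?_ le_rfl)
  set A := (fun y => x + s • y) ⁻¹' (T ∩ ball x s) with hA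
  have hAm : MeasurableSet A :=
    (by fun_prop : Measurable fun y : EuclideanSpace ℝ (Fin n) => x + s • y)
      (hT.inter measurableSet_ball)
  have hAvol : volume.real A = (s ^ n)⁻¹ * volume.real (T ∩ ball x s) :=
    measureReal_preimage_add_smul x hs _
  have hAfin : volume A ≠ ⊤ := by
    refine ((measure_mono ?_).trans_lt (measure_ball_lt_top (x := (0 : EuclideanSpace ℝ (Fin n)))
      (r := 1))).ne
    rintro y ⟨-, hy⟩
    rw [mem_ball_iff_norm, add_sub_cancel_left, norm_smul, Real.norm_of_nonneg hs.le] at hy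
    rw [mem_ball_zero_iff]
    nlinarith [norm_nonneg y]
  have hrhs : Q * ((s ^ n)⁻¹ * volume.real (T ∩ ball x s)) = ∫ y, A.indicator (fun _ => Q) y := by
    rw [integral_indicator_const _ hAm, hAvol, smul_eq_mul, mul_comm]
  rw [hrhs]
  refine integral_mono ?_ ?_ fun y => ?_
  · exact ((hFC.continuous.comp (by fun_prop)).mul
      continuous_avgKer).integrable_of_hasCompactSupport hasCompactSupport_avgKer.mul_left
  · exact (integrable_indicator_iff hAm).2 (integrableOn_const hAfin)
  · by_cases hy : y ∈ ball (0 : EuclideanSpace ℝ (Fin n)) 1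
    · have hz : x + s • y ∈ ball x s := add_smul_mem_ball hs.le le_rfl hs hy
      simp only [hFf _ hz]
      by_cases hyT : x + s • y ∈ T
      · rw [indicator_of_mem (show y ∈ A from ⟨hyT, hz⟩)]
        have := hfQ _ hz
        nlinarith [avgKer_nonneg y, avgKer_le_one y]
      · rw [hfT _ hz hyT, zero_mul]
        exact indicator_nonneg (fun _ _ => hQ) _
    · simp only [avgKer_eq_zero hy, mul_zero]
      exact indicator_nonneg (fun _ _ => hQ) _

theorem lapl_posCube_sub_ge {v : EuclideanSpace ℝ (Fin n) → ℝ} (hv : ContDiff ℝ 2 v) (a : ℝ)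
    (z : EuclideanSpace ℝ (Fin n)) :
    3 * max (v z - a) 0 ^ 2 * lapl n v z ≤ lapl n (fun y => posCube (v y - a)) z := by
  have hdv : ∀ y, HasFDerivAt v (fderiv ℝ v y) y := fun y =>
    ((hv.differentiable (by norm_num)) y).hasFDerivAt
  rw [lapl, lapl, Finset.mul_sum]
  refine Finset.sum_le_sum fun j _ => ?_
  set e : EuclideanSpace ℝ (Fin n) := EuclideanSpace.single j (1 : ℝ)
  have h1 : (fun y => fderiv ℝ (fun y => posCube (v y - a)) y e) =
      fun y => (3 * max (v y - a) 0 ^ 2) * fderiv ℝ v y e := by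
    funext y
    have h' := (hasDerivAt_posCube (v y - a)).comp_hasFDerivAt y ((hdv y).sub_const a)
    have h : HasFDerivAt (fun y => posCube (v y - a)) _ y := h'
    rw [h.fderiv]
    simp
  have h2 : ContDiff ℝ 1 fun y => fderiv ℝ v y e :=
    (hv.fderiv_right (m := 1) (by norm_num)).clm_apply contDiff_const
  have h3' := (hasDerivAt_max_zero_sq (v z - a)).comp_hasFDerivAt z ((hdv z).sub_const a)
  have h3 : HasFDerivAt (fun y => 3 * max (v y - a) 0 ^ 2) _ z := h3'
  have h4 := h3.fun_mul ((h2.differentiable (by norm_num)) z).hasFDerivAt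
  rw [h1, h4.fderiv]
  simp only [add_apply, smul_apply, smul_eq_mul]
  have h5 : 0 ≤ max (v z - a) 0 := le_max_right _ _
  nlinarith [mul_nonneg h5 (sq_nonneg (fderiv ℝ v z e))]

/-- The truncation `(v - a)₊³` on `Ω`, extended by zero. -/
noncomputable def cubeTrunc (Ω : Set (EuclideanSpace ℝ (Fin n)))
    (v : EuclideanSpace ℝ (Fin n) → ℝ) (a : ℝ) : EuclideanSpace ℝ (Fin n) → ℝ :=
  Ω.indicator fun y => posCube (v y - a)

theorem posCube_eq_zero {t : ℝ} (ht : t ≤ 0) : posCube t = 0 := by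
  rw [posCube, max_eq_right ht]; norm_num

theorem posCube_of_nonneg {t : ℝ} (ht : 0 ≤ t) : posCube t = t ^ 3 := by
  rw [posCube, max_eq_left ht]

theorem posCube_nonneg (t : ℝ) : 0 ≤ posCube t := by
  unfold posCube; positivity

theorem posCube_mono : Monotone posCube := fun _ _ h =>
  pow_le_pow_left₀ (le_max_right _ _) (max_le_max_right 0 h) 3

variable {Ω : Set (EuclideanSpace ℝ (Fin n))} {v : EuclideanSpace ℝ (Fin n) → ℝ} {a : ℝ}
  {z : EuclideanSpace ℝ (Fin n)}

theorem cubeTrunc_eventuallyEq (hΩ : IsOpen Ω)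
    (hz : z ∈ closure Ω → z ∉ Ω → ∀ᶠ y in nhds z, y ∈ Ω → v y ≤ a) :
    (z ∈ Ω ∧ cubeTrunc Ω v a =ᶠ[nhds z] fun y => posCube (v y - a)) ∨
      (z ∉ Ω ∧ cubeTrunc Ω v a =ᶠ[nhds z] fun _ => 0) := by
  by_cases h1 : z ∈ Ω
  · refine Or.inl ⟨h1, ?_⟩
    filter_upwards [hΩ.mem_nhds h1] with y hy
    rw [cubeTrunc, indicator_of_mem hy]
  refine Or.inr ⟨h1, ?_⟩
  by_cases h2 : z ∈ closure Ω
  · filter_upwards [hz h2 h1] with y hy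
    by_cases hyΩ : y ∈ Ω
    · rw [cubeTrunc, indicator_of_mem hyΩ, posCube_eq_zero (sub_nonpos.2 (hy hyΩ))]
    · rw [cubeTrunc, indicator_of_notMem hyΩ]
  · filter_upwards [isClosed_closure.isOpen_compl.mem_nhds h2] with y hy
    rw [cubeTrunc, indicator_of_notMem fun h => hy (subset_closure h)]

theorem contDiffAt_cubeTrunc (hΩ : IsOpen Ω) (hv : ContDiff ℝ 2 v)
    (hz : z ∈ closure Ω → z ∉ Ω → ∀ᶠ y in nhds z, y ∈ Ω → v y ≤ a) :
    ContDiffAt ℝ 2 (cubeTrunc Ω v a) z := by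
  rcases cubeTrunc_eventuallyEq hΩ hz with h | h
  · exact (contDiff_posCube.comp (hv.sub contDiff_const)).contDiffAt.congr_of_eventuallyEq h.2
  · exact contDiffAt_const.congr_of_eventuallyEq h.2

theorem lapl_cubeTrunc_ge (hΩ : IsOpen Ω) (hv : ContDiff ℝ 2 v)
    (hz : z ∈ closure Ω → z ∉ Ω → ∀ᶠ y in nhds z, y ∈ Ω → v y ≤ a) {lam A D : ℝ}
    (hlam : 0 ≤ lam) (hA : 0 ≤ A) (hD : 0 ≤ D) (hzl : z ∈ Ω → lapl n v z = -lam * v z)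
    (hz0 : z ∈ Ω → 0 ≤ v z) (hzA : z ∈ Ω → v z ≤ A) (hzD : z ∈ Ω → v z - a ≤ D) :
    -(3 * lam * A * D ^ 2) ≤ lapl n (cubeTrunc Ω v a) z := by
  rcases cubeTrunc_eventuallyEq hΩ hz with ⟨hzΩ, h⟩ | ⟨-, h⟩
  · rw [lapl_congr h]
    refine le_trans ?_ (lapl_posCube_sub_ge hv a z)
    rw [hzl hzΩ]
    have h1 : max (v z - a) 0 ^ 2 ≤ D ^ 2 :=
      pow_le_pow_left₀ (le_max_right _ _) (max_le (hzD hzΩ) hD) 2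
    have h2 : lam * v z ≤ lam * A := mul_le_mul_of_nonneg_left (hzA hzΩ) hlam
    have h3 := mul_le_mul h1 h2 (mul_nonneg hlam (hz0 hzΩ)) (sq_nonneg D)
    nlinarith
  · rw [lapl_congr h]
    have : lapl n (fun _ : EuclideanSpace ℝ (Fin n) => (0 : ℝ)) z = 0 := by simp [lapl]
    rw [this]
    have : 0 ≤ 3 * lam * A * D ^ 2 := by positivity
    linarith

theorem cubeTrunc_le_of_le {D : ℝ} (hD : 0 ≤ D) (h : z ∈ Ω → v z - a ≤ D) :
    cubeTrunc Ω v a z ≤ D ^ 3 := by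
  by_cases hz : z ∈ Ω
  · rw [cubeTrunc, indicator_of_mem hz, ← posCube_of_nonneg hD]
    exact posCube_mono (h hz)
  · rw [cubeTrunc, indicator_of_notMem hz]
    positivity

/-- `Ω` is a positivity domain in the ball `ball x₀ R` of the solution `v` of `Δv = -lam v`. -/
structure IsPosDomain (Ω : Set (EuclideanSpace ℝ (Fin n))) (v : EuclideanSpace ℝ (Fin n) → ℝ)
    (lam : ℝ) (x₀ : EuclideanSpace ℝ (Fin n)) (R : ℝ) : Prop where
  isOpen : IsOpen Ω
  contDiff : ContDiff ℝ 2 v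
  subset : Ω ⊆ ball x₀ R
  lapl_eq : ∀ z ∈ Ω, lapl n v z = -lam * v z
  pos : ∀ z ∈ Ω, 0 < v z
  boundary : ∀ z ∈ ball x₀ R, z ∈ closure Ω → z ∉ Ω → v z = 0

variable {lam R A ε : ℝ} {x₀ : EuclideanSpace ℝ (Fin n)}

/-- If `Ω` occupies a small part of a ball then the values of `v` at the centre of the ball are
small. -/
theorem IsPosDomain.le_of_measureReal_ball_le (h : IsPosDomain Ω v lam x₀ R) (hlam : 0 ≤ lam)
    (hA : 0 < A)
    (hεI : ε + 3 / 2 * ε * (∫ y : EuclideanSpace ℝ (Fin n), avgPot y) ≤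
      (∫ y : EuclideanSpace ℝ (Fin n), avgKer y) / 4096)
    {s : ℝ} (hs : 0 < s) (hls : lam * s ^ 2 ≤ ε) {x : EuclideanSpace ℝ (Fin n)} (hx : x ∈ Ω)
    (hxs : dist x x₀ + s < R) (hvA : ∀ y ∈ Ω ∩ ball x s, v y ≤ A)
    (hvol : volume.real (Ω ∩ ball x s) ≤ ε * s ^ n) : v x ≤ A / 8 := by
  set I := ∫ y : EuclideanSpace ℝ (Fin n), avgKer y with hI
  set P := ∫ y : EuclideanSpace ℝ (Fin n), avgPot y with hP
  have hIpos : 0 < I := integral_avgKer_pos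
  have hP0 : 0 ≤ P := integral_nonneg avgPot_nonneg
  have hfr : ∀ z ∈ ball x₀ R, z ∈ closure Ω → z ∉ Ω → ∀ᶠ y in nhds z, y ∈ Ω → v y ≤ A / 16 := by
    intro z hz h1 h2
    have h3 : v z < A / 16 := by rw [h.boundary z hz h1 h2]; positivity
    filter_upwards [h.contDiff.continuous.continuousAt.eventually_lt_const h3] with y hy _
    exact hy.le
  have hsub : ball x (R - dist x x₀) ⊆ ball x₀ R := ball_subset_ball' (by linarith)
  have hsub' : ball x s ⊆ ball x₀ R := ball_subset_ball' (by linarith)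
  have key := mul_integral_avgKer_le_measureReal (f := cubeTrunc Ω v (A / 16)) (x := x) (s := s)
    (S := R - dist x x₀) (μ := 3 * lam * A * A ^ 2) (Q := A ^ 3) (T := Ω)
    (fun z hz => (contDiffAt_cubeTrunc h.isOpen h.contDiff (hfr z (hsub hz))).contDiffWithinAt)
    hs (by linarith)
    (fun z hz => lapl_cubeTrunc_ge h.isOpen h.contDiff (hfr z (hsub' hz)) hlam hA.le hA.le
      (h.lapl_eq z) (fun hzΩ => (h.pos z hzΩ).le) (fun hzΩ => hvA z ⟨hzΩ, hz⟩)
      (fun hzΩ => by linarith [hvA z ⟨hzΩ, hz⟩]))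
    (by positivity) (fun z hz => cubeTrunc_le_of_le hA.le fun hzΩ => by linarith [hvA z ⟨hzΩ, hz⟩])
    h.isOpen.measurableSet (fun z _ hzT => indicator_of_notMem hzT _)
  rw [← hI, ← hP] at key
  have h1 : (s ^ n)⁻¹ * volume.real (Ω ∩ ball x s) ≤ ε := by
    rw [inv_mul_le_iff₀ (by positivity)]
    linarith
  have h2 : cubeTrunc Ω v (A / 16) x * I ≤ A ^ 3 * (ε + 3 / 2 * ε * P) := by
    have h3 : A ^ 3 * P * (lam * s ^ 2) ≤ A ^ 3 * P * ε :=
      mul_le_mul_of_nonneg_left hls (by positivity)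
    have h4 := mul_le_mul_of_nonneg_left h1 (by positivity : 0 ≤ A ^ 3)
    nlinarith
  have h3 : cubeTrunc Ω v (A / 16) x ≤ (A / 16) ^ 3 := by
    have h4 := h2.trans (mul_le_mul_of_nonneg_left hεI (by positivity))
    have h5 : cubeTrunc Ω v (A / 16) x * I ≤ (A / 16) ^ 3 * I := by
      refine h4.trans (le_of_eq ?_)
      ring
    exact le_of_mul_le_mul_right h5 hIpos
  by_contra hcon
  rw [not_le] at hcon
  rw [cubeTrunc, indicator_of_mem hx, posCube_of_nonneg (by linarith)] at h3
  have := pow_lt_pow_left₀ (show A / 16 < v x - A / 16 by linarith) (by positivity)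
    (show 3 ≠ 0 by norm_num)
  linarith

/-- Growth in narrow domains: if `Ω` has small volume in the shell around the sphere of radius `t`,
then `v` is much smaller inside the sphere than outside of it. -/
theorem IsPosDomain.le_half_of_shell (h : IsPosDomain Ω v lam x₀ R) (hlam : 0 ≤ lam)
    (hA : 0 < A) (hε : 0 < ε)
    (hεI : ε + 3 / 2 * ε * (∫ y : EuclideanSpace ℝ (Fin n), avgPot y) ≤
      (∫ y : EuclideanSpace ℝ (Fin n), avgKer y) / 4096)
    {s t ρ : ℝ} (hs : 0 < s) (hls : lam * s ^ 2 ≤ ε) (hts : t + s < R)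
    (hvA : ∀ y ∈ Ω ∩ ball x₀ (t + s), v y ≤ A)
    (hshell : volume.real (Ω ∩ (ball x₀ (t + s) \ ball x₀ (t - 2 * s))) ≤ ε * s ^ n)
    (hρ : 0 < ρ) (hlρ : lam * ρ ^ 2 ≤ ε) (hvol : volume.real (Ω ∩ ball x₀ t) ≤ ε * ρ ^ n) :
    ∀ y ∈ Ω ∩ ball x₀ t, v y ≤ A / 2 := by
  set I := ∫ y : EuclideanSpace ℝ (Fin n), avgKer y with hI
  set P := ∫ y : EuclideanSpace ℝ (Fin n), avgPot y with hP
  have hIpos : 0 < I := integral_avgKer_pos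
  have hP0 : 0 ≤ P := integral_nonneg avgPot_nonneg
  have hmid : ∀ x ∈ Ω, dist x x₀ < t → t - s < dist x x₀ → v x ≤ A / 8 := by
    intro x hx hxt hxs
    refine h.le_of_measureReal_ball_le hlam hA hεI hs hls hx (by linarith)
      (fun y hy => hvA y ⟨hy.1, ball_subset_ball' (by linarith) hy.2⟩)
      ((measureReal_mono ?_ ?_).trans hshell)
    · rintro y ⟨hy, hyx⟩
      refine ⟨hy, ball_subset_ball' (by linarith) hyx, fun hyt => ?_⟩
      rw [mem_ball] at hyx hyt
      linarith [dist_triangle_left x x₀ y]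
    · exact measure_ne_top_of_subset (fun y hy => hy.2.1) measure_ball_lt_top.ne
  set Ω' := Ω ∩ ball x₀ t with hΩ'
  have hΩ'o : IsOpen Ω' := h.isOpen.inter isOpen_ball
  have hfr : ∀ z, z ∈ closure Ω' → z ∉ Ω' → ∀ᶠ y in nhds z, y ∈ Ω' → v y ≤ A / 8 := by
    intro z hz hz'
    have hzcl : z ∈ closure Ω := closure_mono inter_subset_left hz
    have hzt : dist z x₀ ≤ t := mem_closedBall.1
      (closure_ball_subset_closedBall (closure_mono inter_subset_right hz))
    rcases lt_or_ge (t - s) (dist z x₀) with h1 | h1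
    · have : ∀ᶠ y in nhds z, t - s < dist y x₀ :=
        (continuous_id.dist continuous_const).continuousAt.eventually_const_lt h1
      filter_upwards [this] with y hy hyΩ
      exact hmid y hyΩ.1 hyΩ.2 hy
    · have hzt' : z ∈ ball x₀ t := mem_ball.2 (by linarith)
      have hzΩ : z ∉ Ω := fun hzΩ => hz' ⟨hzΩ, hzt'⟩
      have h3 : v z < A / 8 := by
        rw [h.boundary z (ball_subset_ball (by linarith) hzt') hzcl hzΩ]; positivity
      filter_upwards [h.contDiff.continuous.continuousAt.eventually_lt_const h3] with y hy _
      exact hy.le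
  set W := cubeTrunc Ω' v (A / 8) with hW
  have hWC : ContDiff ℝ 2 W := contDiff_iff_contDiffAt.2 fun z =>
    contDiffAt_cubeTrunc hΩ'o h.contDiff (hfr z)
  have hWs : HasCompactSupport W := HasCompactSupport.intro (isCompact_closedBall x₀ t)
    fun y hy => indicator_of_notMem (fun hyΩ => hy (ball_subset_closedBall hyΩ.2)) _
  obtain ⟨x, hx⟩ := hWC.continuous.exists_forall_ge_of_hasCompactSupport hWs
  have hWeq : ∀ y ∈ Ω', W y = posCube (v y - A / 8) := fun y hy => indicator_of_mem hy _
  suffices hD : ∀ y ∈ Ω', v y - A / 8 ≤ A / 4 by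
    intro y hy
    linarith [hD y hy]
  intro y hy
  by_contra hcon
  rw [not_le] at hcon
  have hyW : 0 < W y := by
    rw [hWeq y hy, posCube_of_nonneg (by linarith)]
    have : 0 < v y - A / 8 := by linarith
    positivity
  have hxW : 0 < W x := hyW.trans_le (hx y)
  have hxΩ : x ∈ Ω' := by
    by_contra hxΩ
    rw [hW, cubeTrunc, indicator_of_notMem hxΩ] at hxW
    exact hxW.false
  set D := v x - A / 8 with hDdef
  have hDpos : 0 < D := by
    by_contra hD
    rw [hWeq x hxΩ, posCube_eq_zero (not_lt.1 hD)] at hxW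
    exact hxW.false
  have hDmax : ∀ z ∈ Ω', v z - A / 8 ≤ D := by
    intro z hz
    by_contra hcon'
    rw [not_le] at hcon'
    have h1 := hx z
    rw [hWeq z hz, hWeq x hxΩ, ← hDdef, posCube_of_nonneg hDpos.le,
      posCube_of_nonneg (by linarith)] at h1
    exact absurd h1 (not_le.2 (pow_lt_pow_left₀ hcon' hDpos.le (by norm_num)))
  have key := mul_integral_avgKer_le_measureReal (f := W) (x := x) (s := ρ) (S := ρ + 1)
    (μ := 3 * lam * A * D ^ 2) (Q := D ^ 3) (T := Ω') hWC.contDiffOn hρ (by linarith)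
    (fun z _ => lapl_cubeTrunc_ge hΩ'o h.contDiff (hfr z) hlam hA.le hDpos.le
      (fun hz => h.lapl_eq z hz.1) (fun hz => (h.pos z hz.1).le)
      (fun hz => hvA z ⟨hz.1, ball_subset_ball (by linarith) hz.2⟩) (hDmax z))
    (by positivity) (fun z _ => cubeTrunc_le_of_le hDpos.le (hDmax z))
    hΩ'o.measurableSet (fun z _ hzT => indicator_of_notMem hzT _)
  rw [← hI, ← hP, hWeq x hxΩ, ← hDdef, posCube_of_nonneg hDpos.le] at key
  have h1 : (ρ ^ n)⁻¹ * volume.real (Ω' ∩ ball x ρ) ≤ ε := by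
    rw [inv_mul_le_iff₀ (by positivity), mul_comm]
    refine (measureReal_mono inter_subset_left ?_).trans hvol
    exact measure_ne_top_of_subset inter_subset_right measure_ball_lt_top.ne
  have h2 : D * I ≤ D * ε + 3 / 2 * ε * P * A := by
    have h3 : A * D ^ 2 * P * (lam * ρ ^ 2) ≤ A * D ^ 2 * P * ε :=
      mul_le_mul_of_nonneg_left hlρ (by positivity)
    have h4 := mul_le_mul_of_nonneg_left h1 (by positivity : 0 ≤ D ^ 3)
    have h5 : D ^ 2 * (D * I) ≤ D ^ 2 * (D * ε + 3 / 2 * ε * P * A) := by nlinarith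
    exact le_of_mul_le_mul_left h5 (by positivity)
  have h3 : A / 4 < D := lt_of_lt_of_le hcon (hDmax y hy)
  have h4 : 0 ≤ 3 / 2 * ε * P := by positivity
  have h5 : D * ε ≤ D * (I / 4096) := mul_le_mul_of_nonneg_left (by linarith) hDpos.le
  have h6 : 3 / 2 * ε * P * A ≤ I / 4096 * A := mul_le_mul_of_nonneg_right (by linarith) hA.le
  nlinarith [mul_lt_mul_of_pos_right h3 hIpos, mul_pos hDpos hIpos]

/-- Exponential decay of `v` inside `ball x₀ b` when `Ω` has small volume in this ball. -/
theorem IsPosDomain.le_mul_rpow (h : IsPosDomain Ω v lam x₀ R) (hlam : 0 ≤ lam)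
    (hA : 0 < A) (hε : 0 < ε)
    (hεI : ε + 3 / 2 * ε * (∫ y : EuclideanSpace ℝ (Fin n), avgPot y) ≤
      (∫ y : EuclideanSpace ℝ (Fin n), avgKer y) / 4096)
    {s b ρ : ℝ} (hs : 0 < s) (hls : lam * s ^ 2 ≤ ε) (hb : b < R)
    (hvA : ∀ y ∈ Ω ∩ ball x₀ b, v y ≤ A)
    (hρ : 0 < ρ) (hlρ : lam * ρ ^ 2 ≤ ε) (hvol : volume.real (Ω ∩ ball x₀ b) ≤ ε * ρ ^ n)
    {d : ℕ} (hd : volume.real (Ω ∩ ball x₀ b) ≤ ε * s ^ n * d / 2) :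
    ∀ y ∈ Ω ∩ ball x₀ (b - 3 * s * d), v y ≤ A * 2 ^ (-(d : ℝ) / 2) := by
  have hfin : ∀ t, volume (Ω ∩ ball x₀ t) ≠ ⊤ := fun t =>
    measure_ne_top_of_subset inter_subset_right measure_ball_lt_top.ne
  have hes : 0 < ε * s ^ n := by positivity
  have key : ∀ j : ℕ, ∀ y ∈ Ω ∩ ball x₀ (b - 3 * s * j), v y ≤
      A * 2 ^ (-(j : ℝ) + (volume.real (Ω ∩ ball x₀ b) -
        volume.real (Ω ∩ ball x₀ (b - 3 * s * j))) / (ε * s ^ n)) := by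
    intro j
    induction j with
    | zero => simpa using fun y hy hyb => hvA y ⟨hy, hyb⟩
    | succ j ih =>
      set β := b - 3 * s * j with hβ
      have hβ' : b - 3 * s * (j + 1 : ℕ) = β - 3 * s := by rw [hβ]; push_cast; ring
      rw [hβ']
      have hβb : β ≤ b := by
        have : 0 ≤ 3 * s * j := by positivity
        linarith
      have hsub : Ω ∩ ball x₀ (β - 3 * s) ⊆ Ω ∩ ball x₀ β :=
        inter_subset_inter_right _ (ball_subset_ball (by linarith))
      have hdiff : Ω ∩ (ball x₀ β \ ball x₀ (β - 3 * s)) =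
          (Ω ∩ ball x₀ β) \ (Ω ∩ ball x₀ (β - 3 * s)) := by
        ext y; simp only [mem_inter_iff, mem_sdiff]; tauto
      have hshell : volume.real (Ω ∩ (ball x₀ β \ ball x₀ (β - 3 * s))) =
          volume.real (Ω ∩ ball x₀ β) - volume.real (Ω ∩ ball x₀ (β - 3 * s)) := by
        rw [hdiff]
        exact measureReal_sdiff hsub (h.isOpen.inter isOpen_ball).measurableSet (hfin _)
      rcases le_or_gt (volume.real (Ω ∩ (ball x₀ β \ ball x₀ (β - 3 * s)))) (ε * s ^ n)
        with hg | hg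
      · intro y hy
        have h1 := h.le_half_of_shell hlam (t := β - s) (A := A * 2 ^ (-(j : ℝ) +
            (volume.real (Ω ∩ ball x₀ b) - volume.real (Ω ∩ ball x₀ β)) / (ε * s ^ n)))
          (by positivity) hε hεI hs hls (by linarith) (by rwa [show β - s + s = β by ring])
          (by rw [show β - s + s = β by ring, show β - s - 2 * s = β - 3 * s by ring]; exact hg)
          hρ hlρ ((measureReal_mono (inter_subset_inter_right _
            (ball_subset_ball (by linarith))) (hfin _)).trans hvol) y
          ⟨hy.1, ball_subset_ball (by linarith) hy.2⟩
        refine h1.trans ?_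
        have h2 : volume.real (Ω ∩ ball x₀ (β - 3 * s)) ≤ volume.real (Ω ∩ ball x₀ β) :=
          measureReal_mono hsub (hfin _)
        rw [mul_div_assoc]
        refine mul_le_mul_of_nonneg_left ?_ hA.le
        rw [div_le_iff₀ (by norm_num)]
        calc _ ≤ (2 : ℝ) ^ (-((j + 1 : ℕ) : ℝ) + (volume.real (Ω ∩ ball x₀ b) -
              volume.real (Ω ∩ ball x₀ (β - 3 * s))) / (ε * s ^ n) + 1) := by
              refine Real.rpow_le_rpow_of_exponent_le (by norm_num) ?_
              have := div_le_div_of_nonneg_right (show volume.real (Ω ∩ ball x₀ b) -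
                volume.real (Ω ∩ ball x₀ β) ≤ volume.real (Ω ∩ ball x₀ b) -
                volume.real (Ω ∩ ball x₀ (β - 3 * s)) by linarith) hes.le
              push_cast
              linarith
          _ = _ := by rw [Real.rpow_add (by norm_num), Real.rpow_one]
      · intro y hy
        refine (ih y (hsub hy)).trans (mul_le_mul_of_nonneg_left ?_ hA.le)
        refine Real.rpow_le_rpow_of_exponent_le (by norm_num) ?_
        rw [hshell] at hg
        have h2 : (volume.real (Ω ∩ ball x₀ b) - volume.real (Ω ∩ ball x₀ (β - 3 * s))) /
            (ε * s ^ n) = (volume.real (Ω ∩ ball x₀ b) - volume.real (Ω ∩ ball x₀ β)) /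
            (ε * s ^ n) + (volume.real (Ω ∩ ball x₀ β) -
            volume.real (Ω ∩ ball x₀ (β - 3 * s))) / (ε * s ^ n) := by ring
        have h3 := (one_lt_div hes).2 hg
        rw [h2]
        push_cast
        linarith
  intro y hy
  refine (key d y hy).trans (mul_le_mul_of_nonneg_left ?_ hA.le)
  refine Real.rpow_le_rpow_of_exponent_le (by norm_num) ?_
  have h1 : (volume.real (Ω ∩ ball x₀ b) - volume.real (Ω ∩ ball x₀ (b - 3 * s * d))) /
      (ε * s ^ n) ≤ d / 2 := by
    rw [div_le_iff₀ hes]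
    have := measureReal_nonneg (μ := volume) (s := Ω ∩ ball x₀ (b - 3 * s * d))
    linarith
  linarith

/-- A nodal domain of an eigenfunction is a positivity domain of `u` or of `-u`. -/
theorem exists_isPosDomain_connectedComponentIn {u : EuclideanSpace ℝ (Fin n) → ℝ}
    (hu : ContDiff ℝ 2 u) (hul : ∀ x ∈ ball x₀ R, lapl n u x = -lam * u x)
    (x : EuclideanSpace ℝ (Fin n)) :
    ∃ w, IsPosDomain (connectedComponentIn {x ∈ ball x₀ R | u x ≠ 0} x) w lam x₀ R ∧
      ∀ y ∈ connectedComponentIn {x ∈ ball x₀ R | u x ≠ 0} x, |u y| = w y := by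
  set F := {x ∈ ball x₀ R | u x ≠ 0} with hF
  set G := connectedComponentIn F x with hG
  have hFo : IsOpen F := isOpen_ball.inter (isOpen_ne_fun hu.continuous continuous_const)
  have hGo : IsOpen G := hFo.connectedComponentIn
  have hGF : G ⊆ F := connectedComponentIn_subset F x
  have hGc : IsPreconnected G := isPreconnected_connectedComponentIn
  have hbd : ∀ z ∈ ball x₀ R, z ∈ closure G → z ∉ G → u z = 0 := by
    intro z hz hzc hzG
    by_contra hne
    have hzF : z ∈ F := ⟨hz, hne⟩
    obtain ⟨w, hw1, hw2⟩ := mem_closure_iff.1 hzc (connectedComponentIn F z)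
      hFo.connectedComponentIn (mem_connectedComponentIn hzF)
    have h1 := connectedComponentIn_eq hw1
    have h2 := connectedComponentIn_eq hw2
    exact hzG (by rw [hG, h2, ← h1]; exact mem_connectedComponentIn hzF)
  have hsign : (∀ y ∈ G, 0 < u y) ∨ ∀ y ∈ G, 0 < -u y := by
    by_contra hcon
    push Not at hcon
    obtain ⟨⟨y, hy, hy0⟩, z, hz, hz0⟩ := hcon
    obtain ⟨w, hw, hw0⟩ := hGc.intermediate_value hy hz hu.continuous.continuousOn
      ⟨hy0, by linarith⟩
    exact (hGF hw).2 hw0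
  rcases hsign with h | h
  · exact ⟨u, ⟨hGo, hu, fun y hy => (hGF hy).1, fun z hz => hul z (hGF hz).1, h, hbd⟩,
      fun y hy => abs_of_pos (h y hy)⟩
  · refine ⟨fun y => -u y, ⟨hGo, hu.neg, fun y hy => (hGF hy).1, fun z hz => ?_, h,
      fun z h1 h2 h3 => by simp [hbd z h1 h2 h3]⟩, fun y hy => abs_of_neg (by linarith [h y hy])⟩
    have hneg : lapl n (fun y => -u y) z = -lapl n u z := by
      simp only [lapl, fderiv_fun_neg, neg_apply, Finset.sum_neg_distrib]
    rw [hneg, hul z (hGF hz).1]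
    ring

end Kernel

/-- A Remez-type inequality in `ball x₀ (2 * r)` forbids large families of nodal domains. -/
theorem false_of_large_family {n : ℕ} (hn : 2 ≤ n) {lam r c p ε ρ M : ℝ}
    {x₀ : EuclideanSpace ℝ (Fin n)} {u : EuclideanSpace ℝ (Fin n) → ℝ}
    (hlam : 0 ≤ lam) (hr : 0 < r) (hc : 0 < c) (hp : 0 ≤ p) (hM : 0 < M) (hε : 0 < ε)
    (hεI : ε + 3 / 2 * ε * (∫ y : EuclideanSpace ℝ (Fin n), avgPot y) ≤
      (∫ y : EuclideanSpace ℝ (Fin n), avgKer y) / 4096)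
    (hρ : 0 < ρ) (hlρ : lam * ρ ^ 2 ≤ ε)
    (T : Finset (Set (EuclideanSpace ℝ (Fin n)))) (hTne : T.Nonempty)
    (hT : ∀ Ω ∈ T, ∃ w, IsPosDomain Ω w lam x₀ (2 * r) ∧ ∀ y ∈ Ω, |u y| = w y)
    (hdisj : (T : Set (Set (EuclideanSpace ℝ (Fin n)))).PairwiseDisjoint id)
    (hmeet : ∀ Ω ∈ T, (Ω ∩ ball x₀ r).Nonempty)
    (huM : ∀ y ∈ ball x₀ (2 * r), |u y| ≤ M)
    (hremez : ∀ E ⊆ ball x₀ (2 * r), MeasurableSet E → 0 < volume E →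
      ∀ A, 0 ≤ A → (∀ y ∈ E, |u y| ≤ A) →
        c * (c * volume.real E / volume.real (ball x₀ (2 * r))) ^ p * M ≤ A)
    {K : ℕ} (hK : 1 ≤ K) (hlK : lam * r ^ 2 ≤ ε * K ^ 2)
    (hTK : volume.real (ball x₀ (2 * r)) * (8 * 12 ^ n * K ^ (n - 1)) ≤ ε * r ^ n * T.card)
    (hTρ : 4 * volume.real (ball x₀ (2 * r)) ≤ ε * ρ ^ n * T.card)
    (hKc : ∀ k : ℕ, (2 : ℝ) ^ (-((K * 2 ^ k : ℕ) : ℝ) / 2) < c * (c * ((4 ^ n)⁻¹) ^ (k + 1)) ^ p) :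
    False := by
  set V := volume.real (ball x₀ (2 * r)) with hV
  have hVpos : 0 < V :=
    ENNReal.toReal_pos (measure_ball_pos volume x₀ (by positivity)).ne' measure_ball_lt_top.ne
  set q : ℝ := (4 ^ n)⁻¹ with hq
  have hqpos : 0 < q := by positivity
  set N : ℝ := (T.card : ℝ) with hN
  have hNpos : 0 < N := by rw [hN]; exact_mod_cast hTne.card_pos
  have hKpos : (0 : ℝ) < K := by exact_mod_cast hK
  have hfin : ∀ (Ω : Set (EuclideanSpace ℝ (Fin n))) (t : ℝ), volume (Ω ∩ ball x₀ t) ≠ ⊤ :=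
    fun Ω t => measure_ne_top_of_subset inter_subset_right measure_ball_lt_top.ne
  have hopen : ∀ Ω ∈ T, IsOpen Ω := fun Ω hΩ => by
    obtain ⟨w, hw, -⟩ := hT Ω hΩ
    exact hw.isOpen
  have hsum : ∀ (J : Finset (Set (EuclideanSpace ℝ (Fin n)))), J ⊆ T → ∀ t,
      volume.real (⋃ Ω ∈ J, Ω ∩ ball x₀ t) = ∑ Ω ∈ J, volume.real (Ω ∩ ball x₀ t) := by
    intro J hJ t
    refine measureReal_biUnion_finset (fun Ω hΩ Ω' hΩ' hne => ?_)
      (fun Ω hΩ => ((hopen Ω (hJ hΩ)).inter isOpen_ball).measurableSet) (fun Ω _ => hfin Ω t)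
    exact (hdisj (hJ hΩ) (hJ hΩ') hne).mono inter_subset_left inter_subset_left
  set R : ℕ → ℝ := fun k => r * (1 + (1 / 2) ^ (k + 1)) with hR
  have hR1 : ∀ k, r ≤ R k := fun k => by
    have : (0 : ℝ) < (1 / 2) ^ (k + 1) := by positivity
    simp only [hR]; nlinarith
  have hR2 : ∀ k, R k < 2 * r := fun k => by
    have : (1 / 2 : ℝ) ^ (k + 1) < 1 := pow_lt_one₀ (by norm_num) (by norm_num) (by omega)
    simp only [hR]; nlinarith
  have claim : ∀ k : ℕ, ∃ J ⊆ T, N * (1 / 2 + (1 / 2) ^ (k + 1)) ≤ J.card ∧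
      ∑ Ω ∈ J, volume.real (Ω ∩ ball x₀ (R k)) ≤ q ^ k * V := by
    intro k
    induction k with
    | zero =>
      refine ⟨T, subset_rfl, by norm_num [hN], ?_⟩
      rw [← hsum T subset_rfl, pow_zero, one_mul]
      refine measureReal_mono (iUnion₂_subset fun Ω _ => ?_) measure_ball_lt_top.ne
      exact inter_subset_right.trans (ball_subset_ball (hR2 0).le)
    | succ k ih =>
      obtain ⟨J, hJT, hJN, hJV⟩ := ih
      set W : ℝ := 2 ^ (k + 2) * q ^ k * V / N with hW
      have hWpos : 0 < W := by positivity
      set J' := J.filter fun Ω => volume.real (Ω ∩ ball x₀ (R k)) ≤ W with hJ'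
      have hJ'J : J' ⊆ J := Finset.filter_subset _ _
      have hJ'T : J' ⊆ T := hJ'J.trans hJT
      refine ⟨J', hJ'T, ?_, ?_⟩
      · have h1 : ((J \ J').card : ℝ) * W ≤ q ^ k * V := by
          rw [← nsmul_eq_mul]
          refine (Finset.card_nsmul_le_sum _ (fun Ω => volume.real (Ω ∩ ball x₀ (R k))) W
            fun Ω hΩ => ?_).trans ((Finset.sum_le_sum_of_subset_of_nonneg Finset.sdiff_subset
              fun _ _ _ => measureReal_nonneg).trans hJV)
          rw [Finset.mem_sdiff, hJ', Finset.mem_filter] at hΩ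
          by_contra hcon
          exact hΩ.2 ⟨hΩ.1, (not_le.1 hcon).le⟩
        have h2 : ((J \ J').card : ℝ) ≤ N * (1 / 2) ^ (k + 2) := by
          have h3 : N * (1 / 2) ^ (k + 2) * W = q ^ k * V := by
            rw [hW, one_div, inv_pow]; field_simp
          exact le_of_mul_le_mul_right (h1.trans h3.ge) hWpos
        have h3 : ((J \ J').card : ℝ) + J'.card = J.card := by
          exact_mod_cast Finset.card_sdiff_add_card_eq_card hJ'J
        have h4 : (1 / 2 : ℝ) ^ (k + 1) = 2 * (1 / 2) ^ (k + 2) := by rw [pow_succ _ (k + 1)]; ring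
        rw [h4] at hJN
        show N * (1 / 2 + (1 / 2) ^ (k + 2)) ≤ J'.card
        nlinarith
      · set d : ℕ := K * 2 ^ k with hd
        set s : ℝ := r * (1 / 4) ^ k / (12 * K) with hs
        have hspos : 0 < s := by positivity
        have hls : lam * s ^ 2 ≤ ε := by
          have h1 : s ≤ r / K := by
            rw [hs, div_le_div_iff₀ (by positivity) hKpos]
            have : (1 / 4 : ℝ) ^ k ≤ 1 := pow_le_one₀ (by norm_num) (by norm_num)
            have h5 : r * (1 / 4) ^ k ≤ r * 1 := mul_le_mul_of_nonneg_left this hr.le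
            nlinarith [mul_le_mul_of_nonneg_right h5 hKpos.le, mul_pos hr hKpos]
          calc lam * s ^ 2 ≤ lam * (r / K) ^ 2 := by gcongr
            _ = lam * r ^ 2 / K ^ 2 := by ring
            _ ≤ ε := by rw [div_le_iff₀ (by positivity)]; exact hlK
        have hRk : R (k + 1) = R k - 3 * s * d := by
          have h1 : (1 / 4 : ℝ) ^ k * 2 ^ k = (1 / 2) ^ k := by rw [← mul_pow]; norm_num
          have h2 : 3 * s * d = r * ((1 / 4 : ℝ) ^ k * 2 ^ k) / 4 := by
            rw [hs, hd]; push_cast; field_simp; norm_num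
          rw [h2, h1]
          simp only [hR, pow_succ]
          ring
        have hWd : W ≤ ε * s ^ n * d / 2 := by
          obtain ⟨m, rfl⟩ : ∃ m, n = m + 1 := ⟨n - 1, by omega⟩
          rw [Nat.add_sub_cancel] at hTK
          have h1 : ε * s ^ (m + 1) * d / 2 =
              2 ^ k * q ^ k * (ε * r ^ (m + 1) / (2 * 12 ^ (m + 1) * K ^ m)) := by
            have h4 : ((1 / 4 : ℝ) ^ k) ^ (m + 1) = q ^ k := by
              rw [hq, ← pow_mul, mul_comm, pow_mul, one_div, inv_pow]
            rw [hs, hd, div_pow, mul_pow, h4]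
            push_cast
            field_simp
            ring
          have h2 : W = 2 ^ k * q ^ k * (4 * V / N) := by rw [hW, pow_add]; ring
          rw [h1, h2]
          refine mul_le_mul_of_nonneg_left ?_ (by positivity)
          rw [div_le_div_iff₀ hNpos (by positivity)]
          linarith
        have hWρ : W ≤ ε * ρ ^ n := by
          have h1 : 2 ^ k * q ^ k ≤ 1 := by
            rw [← mul_pow]
            refine pow_le_one₀ (by positivity) ?_
            rw [hq, mul_inv_le_iff₀ (by positivity), one_mul]
            calc (2 : ℝ) ≤ 4 ^ 1 := by norm_num
              _ ≤ 4 ^ n := pow_le_pow_right₀ (by norm_num) (by omega)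
          have h2 : W = 2 ^ k * q ^ k * (4 * V / N) := by rw [hW, pow_add]; ring
          rw [h2]
          refine (mul_le_of_le_one_left (by positivity) h1).trans ?_
          rwa [div_le_iff₀ hNpos]
        have hsmall : ∀ y ∈ ⋃ Ω ∈ J', Ω ∩ ball x₀ (R (k + 1)),
            |u y| ≤ M * 2 ^ (-(d : ℝ) / 2) := by
          intro y hy
          obtain ⟨Ω, hΩ, hyΩ⟩ := mem_iUnion₂.1 hy
          obtain ⟨w, hw, hwu⟩ := hT Ω (hJ'T hΩ)
          have hvol := (Finset.mem_filter.1 hΩ).2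
          rw [hwu y hyΩ.1]
          refine hw.le_mul_rpow hlam hM hε hεI hspos hls (hR2 k) (fun z hz => ?_) hρ hlρ
            (hvol.trans hWρ) (hvol.trans hWd) y (by rwa [← hRk])
          rw [← hwu z hz.1]
          exact huM z (hw.subset hz.1)
        rw [← hsum J' hJ'T]
        by_contra hcon
        rw [not_le] at hcon
        set E := ⋃ Ω ∈ J', Ω ∩ ball x₀ (R (k + 1)) with hE
        have hEsub : E ⊆ ball x₀ (2 * r) := iUnion₂_subset fun Ω _ =>
          inter_subset_right.trans (ball_subset_ball (hR2 _).le)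
        have hEm : MeasurableSet E := (isOpen_biUnion fun Ω hΩ =>
          (hopen Ω (hJ'T hΩ)).inter isOpen_ball).measurableSet
        have hEpos : 0 < volume.real E := lt_trans (by positivity) hcon
        have h1 := hremez E hEsub hEm (ENNReal.toReal_pos_iff.1 hEpos).1 _ (by positivity) hsmall
        have h2 : c * (c * q ^ (k + 1)) ^ p * M ≤ c * (c * volume.real E / V) ^ p * M := by
          gcongr
          rw [le_div_iff₀ hVpos, mul_assoc]
          exact mul_le_mul_of_nonneg_left hcon.le hc.le
        have h3 := mul_lt_mul_of_pos_right (hKc k) hM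
        linarith
  obtain ⟨Ω₀, hΩ₀, hmin⟩ := T.exists_min_image (fun Ω => volume.real (Ω ∩ ball x₀ r)) hTne
  have hδ : 0 < volume.real (Ω₀ ∩ ball x₀ r) := by
    refine ENNReal.toReal_pos ?_ (hfin _ _)
    exact (((hopen Ω₀ hΩ₀).inter isOpen_ball).measure_pos volume (hmeet Ω₀ hΩ₀)).ne'
  have hq1 : q < 1 := by
    rw [hq]
    exact inv_lt_one_of_one_lt₀ (one_lt_pow₀ (by norm_num) (by omega))
  obtain ⟨k, hk⟩ := exists_pow_lt_of_lt_one (div_pos hδ hVpos) hq1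
  rw [lt_div_iff₀ hVpos] at hk
  obtain ⟨J, hJT, hJN, hJV⟩ := claim k
  have hJ : J.Nonempty := by
    rw [← Finset.card_pos]
    have : (0 : ℝ) < J.card := lt_of_lt_of_le (by positivity) hJN
    exact_mod_cast this
  obtain ⟨Ω, hΩ⟩ := hJ
  have h1 : volume.real (Ω ∩ ball x₀ r) ≤ volume.real (Ω ∩ ball x₀ (R k)) :=
    measureReal_mono (inter_subset_inter_right _ (ball_subset_ball (hR1 k))) (hfin _ _)
  have h2 := Finset.single_le_sum (f := fun Ω => volume.real (Ω ∩ ball x₀ (R k)))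
    (fun _ _ => measureReal_nonneg) hΩ
  have h3 := hmin Ω (hJT hΩ)
  linarith

/-- A rate `K ≥ D * m` beats the loss in the iterated Remez inequality with exponent `C * m`. -/
theorem exists_rate (n : ℕ) {c C : ℝ} (hc : 0 < c) (hC : 0 < C) :
    ∃ D : ℝ, 0 < D ∧ ∀ m : ℝ, 1 ≤ m → ∀ K : ℕ, D * m ≤ K → ∀ k : ℕ,
      (2 : ℝ) ^ (-((K * 2 ^ k : ℕ) : ℝ) / 2) < c * (c * ((4 ^ n)⁻¹) ^ (k + 1)) ^ (C * m) := by
  have hl2 : 0 < Real.log 2 := Real.log_pos (by norm_num)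
  have hl4 : 0 < Real.log 4 := Real.log_pos (by norm_num)
  set L := |Real.log c| with hL
  have hL0 : 0 ≤ L := abs_nonneg _
  have hLc : -L ≤ Real.log c := neg_abs_le _
  set S := L + L * C + C * (n * Real.log 4) with hS
  have hS0 : 0 ≤ S := by positivity
  refine ⟨2 * (S + 1) / Real.log 2, by positivity, fun m hm K hK k => ?_⟩
  have hq : (0 : ℝ) < c * ((4 ^ n)⁻¹) ^ (k + 1) := by positivity
  rw [← Real.log_lt_log_iff (by positivity) (by positivity), Real.log_rpow (by norm_num),
    Real.log_mul hc.ne' (by positivity), Real.log_rpow hq, Real.log_mul hc.ne' (by positivity),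
    Real.log_pow, Real.log_inv, Real.log_pow]
  push_cast
  have h2k : (k : ℝ) + 1 ≤ 2 ^ k := by exact_mod_cast Nat.lt_two_pow_self
  have h1k : (1 : ℝ) ≤ 2 ^ k := one_le_pow₀ (by norm_num)
  have hm0 : 0 < m := by linarith
  have hK' : (S + 1) * m * 2 ^ k ≤ K * 2 ^ k / 2 * Real.log 2 := by
    rw [div_mul_eq_mul_div, div_le_iff₀ hl2] at hK
    nlinarith
  have hm2 : 1 ≤ m * 2 ^ k := one_le_mul_of_one_le_of_one_le hm h1k
  have hmm : m ≤ m * 2 ^ k := le_mul_of_one_le_right hm0.le h1k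
  have hmk : m * (k + 1) ≤ m * 2 ^ k := mul_le_mul_of_nonneg_left h2k hm0.le
  have e1 : -(L * (m * 2 ^ k)) ≤ Real.log c := by nlinarith
  have e2 : -(L * C * (m * 2 ^ k)) ≤ C * m * Real.log c := by
    have : C * m * (-L) ≤ C * m * Real.log c := mul_le_mul_of_nonneg_left hLc (by positivity)
    nlinarith [mul_le_mul_of_nonneg_left hmm (mul_nonneg hL0 hC.le)]
  have e3 : C * (n * Real.log 4) * (m * (k + 1)) ≤ C * (n * Real.log 4) * (m * 2 ^ k) :=
    mul_le_mul_of_nonneg_left hmk (by positivity)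
  have : (S + 1) * m * 2 ^ k = L * (m * 2 ^ k) + L * C * (m * 2 ^ k)
      + C * (n * Real.log 4) * (m * 2 ^ k) + m * 2 ^ k := by rw [hS]; ring
  nlinarith

/-- `(m * (1 + r)) ^ (n - 1)` is controlled by `m ^ n * r ^ n + m ^ (n - 1)`. -/
theorem mul_one_add_pow_le {n : ℕ} {m r : ℝ} (hm : 1 ≤ m) (hr : 0 < r) :
    (m * (1 + r)) ^ (n - 1) ≤ 2 ^ (n - 1) * (m ^ n * r ^ n + m ^ (n - 1)) := by
  have hm0 : 0 < m := by linarith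
  rcases le_total r 1 with h | h
  · have h1 : (m * (1 + r)) ^ (n - 1) ≤ (2 * m) ^ (n - 1) :=
      pow_le_pow_left₀ (by positivity) (by nlinarith) _
    rw [mul_pow 2 m] at h1
    have : 0 ≤ (2 : ℝ) ^ (n - 1) * (m ^ n * r ^ n) := by positivity
    linarith
  · have h1 : (m * (1 + r)) ^ (n - 1) ≤ (2 * (m * r)) ^ (n - 1) :=
      pow_le_pow_left₀ (by positivity) (by nlinarith) _
    have h2 : (m * r) ^ (n - 1) ≤ (m * r) ^ n :=
      pow_le_pow_right₀ (one_le_mul_of_one_le_of_one_le hm h) (Nat.sub_le _ _)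
    rw [mul_pow 2 (m * r)] at h1
    rw [← mul_pow]
    have : 0 ≤ (2 : ℝ) ^ (n - 1) * m ^ (n - 1) := by positivity
    nlinarith [mul_le_mul_of_nonneg_left h2 (by positivity : (0 : ℝ) ≤ 2 ^ (n - 1))]

/-- Nodal domains: connected components of the complement of the zero set in `ball x₀ R` that
meet `ball x₀ r`. -/
def nodalDomains {n : ℕ} (u : EuclideanSpace ℝ (Fin n) → ℝ) (x₀ : EuclideanSpace ℝ (Fin n))
    (R r : ℝ) : Set (Set (EuclideanSpace ℝ (Fin n))) :=
  {Ω | (∃ x ∈ {x ∈ ball x₀ R | u x ≠ 0},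
      Ω = connectedComponentIn {x ∈ ball x₀ R | u x ≠ 0} x) ∧ (Ω ∩ ball x₀ r).Nonempty}

theorem pairwiseDisjoint_nodalDomains {n : ℕ} (u : EuclideanSpace ℝ (Fin n) → ℝ)
    (x₀ : EuclideanSpace ℝ (Fin n)) (R r : ℝ) : (nodalDomains u x₀ R r).PairwiseDisjoint id := by
  rintro _ ⟨⟨x, hx, rfl⟩, -⟩ _ ⟨⟨y, hy, rfl⟩, -⟩ hne
  rw [Function.onFun, id, id, Set.disjoint_left]
  intro z hzx hzy
  exact hne ((connectedComponentIn_eq hzx).trans (connectedComponentIn_eq hzy).symm)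

theorem biSup_abs_le {α : Type*} {u : α → ℝ} {E : Set α} {A : ℝ} (hA : 0 ≤ A)
    (h : ∀ y ∈ E, |u y| ≤ A) : ⨆ y ∈ E, |u y| ≤ A :=
  Real.iSup_le (fun y => Real.iSup_le (fun hy => h y hy) hA) hA

theorem abs_le_biSup_ball {n : ℕ} {u : EuclideanSpace ℝ (Fin n) → ℝ} (hu : Continuous u)
    {x₀ : EuclideanSpace ℝ (Fin n)} {R : ℝ} {y : EuclideanSpace ℝ (Fin n)} (hy : y ∈ ball x₀ R) :
    |u y| ≤ ⨆ x ∈ ball x₀ R, |u x| := by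
  obtain ⟨A, hA⟩ := (isCompact_closedBall x₀ R).exists_bound_of_continuousOn hu.continuousOn
  have hA0 : 0 ≤ A := (norm_nonneg _).trans (hA y (ball_subset_closedBall hy))
  have hbdd : BddAbove (range fun x => ⨆ _ : x ∈ ball x₀ R, |u x|) := by
    refine ⟨A, ?_⟩
    rintro _ ⟨x, rfl⟩
    exact Real.iSup_le (fun hx => hA x (ball_subset_closedBall hx)) hA0
  refine le_trans ?_ (le_ciSup hbdd y)
  simp [hy]

/-- Finite families of nodal domains are small when `u` satisfies a Remez-type inequality. -/
theorem exists_card_nodalDomains_le {n : ℕ} (hn : 2 ≤ n) {c C : ℝ} (hc : 0 < c) (hC : 0 < C) :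
    ∃ C' : ℝ, 0 < C' ∧ ∀ {m r : ℝ} {x₀ : EuclideanSpace ℝ (Fin n)}
      {u : EuclideanSpace ℝ (Fin n) → ℝ}, 1 ≤ m → 0 < r → ContDiff ℝ 2 u →
      (∀ x ∈ ball x₀ (2 * r), lapl n u x = -m ^ 2 * u x) →
      (∀ E ⊆ ball x₀ (2 * r), MeasurableSet E → 0 < volume E →
        c * (c * volume.real E / volume.real (ball x₀ (2 * r))) ^ (C * m) *
          ⨆ x ∈ ball x₀ (2 * r), |u x| ≤ ⨆ x ∈ E, |u x|) →
      ∀ T : Finset (Set (EuclideanSpace ℝ (Fin n))), ↑T ⊆ nodalDomains u x₀ (2 * r) r →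
        (T.card : ℝ) ≤ C' * (m ^ n * r ^ n + m ^ (n - 1)) := by
  obtain ⟨D, hD, hrate⟩ := exists_rate n hc hC
  set I := ∫ y : EuclideanSpace ℝ (Fin n), avgKer y with hI
  set P := ∫ y : EuclideanSpace ℝ (Fin n), avgPot y with hP
  have hIpos : 0 < I := integral_avgKer_pos
  have hPnn : 0 ≤ P := integral_nonneg fun y => avgPot_nonneg y
  set ε := I / (8192 * (1 + P)) with hε
  have hεpos : 0 < ε := by positivity
  have hεI : ε + 3 / 2 * ε * P ≤ I / 4096 := by
    have : ε * (8192 * (1 + P)) = I := div_mul_cancel₀ _ (by positivity)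
    nlinarith
  set s := √ε with hs
  have hspos : 0 < s := Real.sqrt_pos.2 hεpos
  have hs2 : s ^ 2 = ε := Real.sq_sqrt hεpos.le
  set ω := volume.real (ball (0 : EuclideanSpace ℝ (Fin n)) 1) with hω
  have hωpos : 0 < ω :=
    ENNReal.toReal_pos (measure_ball_pos volume _ one_pos).ne' measure_ball_lt_top.ne
  set G := 1 / s + D + 1 with hG
  have hGpos : 0 < G := by positivity
  set C₁ := ω * 2 ^ n * (8 * 12 ^ n * (2 * G) ^ (n - 1)) / ε with hC₁
  set C₂ := 4 * (ω * 2 ^ n) / (ε * s ^ n) with hC₂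
  have hC₁pos : 0 < C₁ := by positivity
  have hC₂pos : 0 < C₂ := by positivity
  refine ⟨C₁ + C₂, by positivity, ?_⟩
  intro m r x₀ u hm hr hu hul hremez T hT
  have hm0 : 0 < m := by linarith
  set X := m ^ n * r ^ n + m ^ (n - 1) with hX
  have hXpos : 0 < X := by positivity
  by_contra! hcard
  have hV : volume.real (ball x₀ (2 * r)) = ω * 2 ^ n * r ^ n := by
    rw [measureReal_def, Measure.addHaar_ball_of_pos _ _ (by positivity), ENNReal.toReal_mul,
      finrank_euclideanSpace_fin, ENNReal.toReal_ofReal (by positivity), ← measureReal_def, ← hω]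
    ring
  have hTne : T.Nonempty := by
    rw [← Finset.card_pos]
    have : (0 : ℝ) < T.card := lt_trans (by positivity) hcard
    exact_mod_cast this
  have hTdom : ∀ Ω ∈ T, ∃ w, IsPosDomain Ω w (m ^ 2) x₀ (2 * r) ∧ ∀ y ∈ Ω, |u y| = w y := by
    intro Ω hΩ
    obtain ⟨⟨x, -, rfl⟩, -⟩ := hT hΩ
    exact exists_isPosDomain_connectedComponentIn hu hul x
  have hM : 0 < ⨆ x ∈ ball x₀ (2 * r), |u x| := by
    obtain ⟨Ω, hΩ⟩ := hTne
    obtain ⟨⟨x, hx, -⟩, -⟩ := hT hΩ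
    exact (abs_pos.2 hx.2).trans_le (abs_le_biSup_ball hu.continuous hx.1)
  set K := ⌈r * m / s + D * m⌉₊ with hK
  have hKle : r * m / s + D * m ≤ K := Nat.le_ceil _
  have hKpos : 0 < K := Nat.ceil_pos.2 (by positivity)
  have hKG : (K : ℝ) ≤ G * (m * (1 + r)) := by
    have h1 : (K : ℝ) < r * m / s + D * m + 1 := Nat.ceil_lt_add_one (by positivity)
    have h2 : G * (m * (1 + r)) = r * m / s + D * m + m + (m / s + D * (m * r) + m * r) := by
      rw [hG]; ring
    have : 0 ≤ m / s + D * (m * r) + m * r := by positivity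
    linarith
  have hKX : (K : ℝ) ^ (n - 1) ≤ (2 * G) ^ (n - 1) * X := by
    calc (K : ℝ) ^ (n - 1) ≤ (G * (m * (1 + r))) ^ (n - 1) :=
          pow_le_pow_left₀ (by positivity) hKG _
      _ = G ^ (n - 1) * (m * (1 + r)) ^ (n - 1) := mul_pow _ _ _
      _ ≤ G ^ (n - 1) * (2 ^ (n - 1) * X) := by
          gcongr
          exact mul_one_add_pow_le hm hr
      _ = (2 * G) ^ (n - 1) * X := by rw [mul_pow]; ring
  have hTC₁ : C₁ * X ≤ T.card := by nlinarith
  have hTC₂ : C₂ * (m ^ n * r ^ n) ≤ T.card := by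
    have h1 : C₂ * (m ^ n * r ^ n) ≤ C₂ * X := by
      gcongr
      rw [hX]
      linarith [pow_pos hm0 (n - 1)]
    nlinarith
  refine false_of_large_family hn (lam := m ^ 2) (p := C * m) (ρ := s / m) (by positivity) hr hc
    (by positivity) hM hεpos hεI (by positivity) ?_ T hTne hTdom
    ((pairwiseDisjoint_nodalDomains u x₀ (2 * r) r).subset hT) (fun Ω hΩ => (hT hΩ).2)
    (fun y hy => abs_le_biSup_ball hu.continuous hy) ?_ (K := K) hKpos ?_ ?_ ?_ ?_
  · rw [div_pow, hs2]
    field_simp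
    exact le_rfl
  · intro E hE hEm hE0 A hA hEA
    exact (hremez E hE hEm hE0).trans (biSup_abs_le hA hEA)
  · have h1 : r * m ≤ s * K := by
      have : r * m / s ≤ K := by linarith [mul_pos hD hm0]
      rw [div_le_iff₀ hspos] at this
      linarith
    calc m ^ 2 * r ^ 2 = (r * m) ^ 2 := by ring
      _ ≤ (s * K) ^ 2 := pow_le_pow_left₀ (by positivity) h1 2
      _ = ε * K ^ 2 := by rw [mul_pow, hs2]
  · rw [hV]
    calc ω * 2 ^ n * r ^ n * (8 * 12 ^ n * (K : ℝ) ^ (n - 1))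
        ≤ ω * 2 ^ n * r ^ n * (8 * 12 ^ n * ((2 * G) ^ (n - 1) * X)) := by gcongr
      _ = ε * r ^ n * (C₁ * X) := by rw [hC₁]; field_simp
      _ ≤ ε * r ^ n * T.card := by gcongr
  · rw [hV]
    calc 4 * (ω * 2 ^ n * r ^ n) = ε * (s / m) ^ n * (C₂ * (m ^ n * r ^ n)) := by
          rw [hC₂, div_pow]; field_simp
      _ ≤ ε * (s / m) ^ n * T.card := by gcongr
  · exact hrate m hm K (by linarith [show 0 < r * m / s by positivity])

/-- Local bound on the number of nodal domains (Theorem 2, second part), assuming the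
Remez-type inequality as a hypothesis. -/
theorem stmt_1 (n : ℕ) (hn : 2 ≤ n) (c C : ℝ) (hc : 0 < c) (hC : 0 < C) :
    ∃ C' : ℝ, 0 < C' ∧
      ∀ (lam r : ℝ) (x₀ : EuclideanSpace ℝ (Fin n))
        (u : EuclideanSpace ℝ (Fin n) → ℝ),
        2 < lam → 0 < r →
        ContDiff ℝ 2 u →
        (∀ x ∈ ball x₀ (2 * r), lapl n u x = -lam * u x) →
        (∀ (y : EuclideanSpace ℝ (Fin n)) (ρ : ℝ), 0 < ρ →
          ball y ρ ⊆ ball x₀ (2 * r) →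
          ∀ E : Set (EuclideanSpace ℝ (Fin n)), E ⊆ ball y ρ → MeasurableSet E →
            0 < volume E →
            (⨆ x ∈ E, |u x|) ≥
              c * (c * (volume E).toReal / (volume (ball y ρ)).toReal) ^
                  (C * Real.sqrt lam) * ⨆ x ∈ ball y ρ, |u x|) →
        {Ω : Set (EuclideanSpace ℝ (Fin n)) |
            (∃ x ∈ {x ∈ ball x₀ (2 * r) | u x ≠ 0},
              Ω = connectedComponentIn {x ∈ ball x₀ (2 * r) | u x ≠ 0} x) ∧
            (Ω ∩ ball x₀ r).Nonempty}.Finite ∧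
        ({Ω : Set (EuclideanSpace ℝ (Fin n)) |
            (∃ x ∈ {x ∈ ball x₀ (2 * r) | u x ≠ 0},
              Ω = connectedComponentIn {x ∈ ball x₀ (2 * r) | u x ≠ 0} x) ∧
            (Ω ∩ ball x₀ r).Nonempty}.ncard : ℝ) ≤
          C' * (lam ^ ((n : ℝ) / 2) * r ^ n + lam ^ (((n : ℝ) - 1) / 2)) := by
  obtain ⟨C', hC', hbound⟩ := exists_card_nodalDomains_le hn hc hC
  refine ⟨C', hC', fun lam r x₀ u hlam hr hu hul hremez => ?_⟩
  have hm : 1 ≤ √lam := Real.one_le_sqrt.2 (by linarith)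
  have hm2 : √lam ^ 2 = lam := Real.sq_sqrt (by linarith)
  have hpow : ∀ k : ℕ, lam ^ ((k : ℝ) / 2) = √lam ^ k := fun k => by
    rw [Real.sqrt_eq_rpow, ← Real.rpow_mul_natCast (by linarith)]
    congr 1
    ring
  have hX : lam ^ ((n : ℝ) / 2) * r ^ n + lam ^ (((n : ℝ) - 1) / 2) =
      √lam ^ n * r ^ n + √lam ^ (n - 1) := by
    rw [hpow, ← hpow (n - 1), Nat.cast_sub (by omega), Nat.cast_one]
  have hT := hbound hm hr hu (by rwa [hm2])
    (fun E hE hEm hE0 => hremez x₀ (2 * r) (by positivity) subset_rfl E hE hEm hE0)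
  rw [hX]
  change (nodalDomains u x₀ (2 * r) r).Finite ∧ ((nodalDomains u x₀ (2 * r) r).ncard : ℝ) ≤ _
  have hfin : (nodalDomains u x₀ (2 * r) r).Finite := by
    by_contra hinf
    obtain ⟨T, hTS, hTc⟩ := Set.Infinite.exists_subset_card_eq hinf
      (⌊C' * (√lam ^ n * r ^ n + √lam ^ (n - 1))⌋₊ + 1)
    have h := hT T hTS
    rw [hTc] at h
    push_cast at h
    linarith [Nat.lt_floor_add_one (C' * (√lam ^ n * r ^ n + √lam ^ (n - 1)))]
  refine ⟨hfin, ?_⟩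
  rw [Set.ncard_eq_toFinset_card _ hfin]
  exact hT _ hfin.coe_toFinset.subset
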